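/- Let p be a prime, k ≥ 1, m = p^k, and λ : ℤ →₀ ZMod m with S_λ bijective. If n ∈ ℤ and there exists a group automorphism ξ of ℤ →₀ ZMod m with S_λ = ξ⁻¹ ∘ σ^n ∘ ξ, then |n| = deg(λ). -/

import Mathlib

/-- The one-dimensional finitary linear cellular automaton `S_lam` on `ZZ ->0 ZMod m`:
`(S_lam a) n = sum_i lam i * a (n + i)`. -/
noncomputable def SCA (m : ℕ) (lam : ℤ →₀ ZMod m) (a : ℤ →₀ ZMod m) : ℤ →₀ ZMod m :=
  lam.sum fun i c => c • Finsupp.equivMapDomain (Equiv.subRight i) a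

/-- The `t`-th power of the right shift: `(sigma^t a) n = a (n - t)`. -/
def shiftT (m : ℕ) (t : ℤ) (a : ℤ →₀ ZMod m) : ℤ →₀ ZMod m :=
  Finsupp.equivMapDomain (Equiv.addRight t) a

/-- The reduced support `supp*(lam) = {i : lam i is a unit of ZMod m}`. -/
noncomputable def redSupp (m : ℕ) (lam : ℤ →₀ ZMod m) : Finset ℤ :=
  letI := Classical.decPred fun i : ℤ => IsUnit (lam i)
  lam.support.filter fun i => IsUnit (lam i)

/-- The degree of `S_lam`, computed from the reduced support:
`deg lam = max(r',0) - min(l',0)` where `l' = min supp*(lam)`, `r' = max supp*(lam)`;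
`deg lam = 0` if the reduced support is empty. -/
noncomputable def degS (m : ℕ) (lam : ℤ →₀ ZMod m) : ℤ :=
  if h : (redSupp m lam).Nonempty
  then max ((redSupp m lam).max' h) 0 - min ((redSupp m lam).min' h) 0
  else 0


section aux

theorem aux_sca_apply (m : ℕ) (lam a : ℤ →₀ ZMod m) (n : ℤ) :
    SCA m lam a n = ∑ i ∈ lam.support, lam i * a (n + i) := by
  unfold SCA Finsupp.sum
  rw [Finsupp.finsetSum_apply]
  refine Finset.sum_congr rfl fun i _ => ?_
  simp [Finsupp.equivMapDomain_apply, Equiv.subRight]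

theorem aux_sca_single (m : ℕ) (lam : ℤ →₀ ZMod m) (i : ℤ) :
    SCA m lam (Finsupp.single i 1) = lam.sum fun j c => Finsupp.single (i - j) c := by
  unfold SCA
  refine Finsupp.sum_congr fun j _ => ?_
  simp [Finsupp.equivMapDomain_single]

noncomputable def auxS (m : ℕ) (lam : ℤ →₀ ZMod m) : AddMonoid.End (ℤ →₀ ZMod m) :=
  AddMonoidHom.mk' (SCA m lam) (by
    intro a b
    ext n
    simp [aux_sca_apply, mul_add, Finset.sum_add_distrib])

noncomputable def auxT (m : ℕ) (t : ℤ) : AddMonoid.End (ℤ →₀ ZMod m) :=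
  AddMonoidHom.mk' (shiftT m t) (by
    intro a b
    ext n
    simp [shiftT, Finsupp.equivMapDomain_apply])

theorem aux_mul_apply {A : Type*} [AddCommMonoid A] (f g : AddMonoid.End A) (a : A) :
    (f * g) a = f (g a) := rfl

theorem aux_hom_single {m p : ℕ} [NeZero m] (hd : p ∣ m) (f : (ℤ →₀ ZMod m) →+ ZMod p) (i : ℤ)
    (c : ZMod m) :
    f (Finsupp.single i c) = ZMod.castHom hd (ZMod p) c * f (Finsupp.single i 1) := by
  have h : Finsupp.single i c = c.val • Finsupp.single i (1 : ZMod m) := by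
    rw [Finsupp.smul_single, nsmul_eq_mul, mul_one, ZMod.natCast_zmod_val]
  have h2 : ZMod.castHom hd (ZMod p) c = (c.val : ZMod p) := by
    conv_lhs => rw [← ZMod.natCast_zmod_val c]
    rw [map_natCast]
  rw [h, map_nsmul, h2, nsmul_eq_mul]

noncomputable def auxF {m p : ℕ} (hd : p ∣ m) (g : ℤ → ZMod p) : (ℤ →₀ ZMod m) →+ ZMod p :=
  Finsupp.liftAddHom fun i => (AddMonoidHom.mulRight (g i)).comp
    (ZMod.castHom hd (ZMod p)).toAddMonoidHom

theorem auxF_single {m p : ℕ} (hd : p ∣ m) (g : ℤ → ZMod p) (i : ℤ) :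
    auxF hd g (Finsupp.single i 1) = g i := by
  have h : auxF hd g (Finsupp.single i 1) = ZMod.castHom hd (ZMod p) 1 * g i := by
    unfold auxF
    rw [Finsupp.liftAddHom_apply_single]
    rfl
  rw [h, map_one, one_mul]

theorem aux_ext {m p : ℕ} [NeZero m] (hd : p ∣ m) (f g : (ℤ →₀ ZMod m) →+ ZMod p)
    (h : ∀ i, f (Finsupp.single i 1) = g (Finsupp.single i 1)) : f = g := by
  refine Finsupp.addHom_ext fun i c => ?_
  rw [aux_hom_single hd f, aux_hom_single hd g, h]

theorem aux_card {m p : ℕ} [NeZero m] (hd : p ∣ m) (φ : AddMonoid.End (ℤ →₀ ZMod m)) (N : ℤ)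
    (h : ∀ f : (ℤ →₀ ZMod m) →+ ZMod p, ∀ i,
      f (φ (Finsupp.single i 1)) = f (Finsupp.single (i + N) 1)) :
    Nat.card {f : (ℤ →₀ ZMod m) →+ ZMod p // ∀ a, f (φ a) = f a}
      = Nat.card (ZMod N.natAbs → ZMod p) := by
  symm
  have hN : ((N : ℤ) : ZMod N.natAbs) = 0 := by
    rw [ZMod.intCast_zmod_eq_zero_iff_dvd]; exact Int.natAbs_dvd.2 dvd_rfl
  let G : (ZMod N.natAbs → ZMod p) → {f : (ℤ →₀ ZMod m) →+ ZMod p // ∀ a, f (φ a) = f a} :=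
    fun u => ⟨auxF hd fun i => u i, by
      intro a
      have : (auxF hd fun i => u i).comp (φ : (ℤ →₀ ZMod m) →+ (ℤ →₀ ZMod m)) = auxF hd fun i => u i := by
        refine aux_ext hd _ _ fun i => ?_
        refine (h (auxF hd fun i => u i) i).trans ?_
        rw [auxF_single, auxF_single]
        push_cast
        rw [hN, add_zero]
      exact DFunLike.congr_fun this a⟩
  refine Nat.card_congr (Equiv.ofBijective G ⟨?_, ?_⟩)
  · intro u v huv
    funext z
    obtain ⟨i, rfl⟩ := ZMod.intCast_surjective z
    have := congrArg (fun f => f.1 (Finsupp.single i 1)) huv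
    simpa [G, auxF_single] using this
  · rintro ⟨f, hf⟩
    have hper : Function.Periodic (fun i : ℤ => f (Finsupp.single i 1)) N := by
      intro i
      show f _ = f _
      rw [← h, hf]
    refine ⟨fun z => f (Finsupp.single (Function.surjInv ZMod.intCast_surjective z) 1), ?_⟩
    apply Subtype.ext
    refine aux_ext hd _ _ fun i => ?_
    simp only [G]
    rw [auxF_single]
    set j := Function.surjInv (ZMod.intCast_surjective (n := N.natAbs)) (i : ZMod N.natAbs) with hj
    have hji : ((j : ℤ) : ZMod N.natAbs) = i := Function.surjInv_eq _ _
    rw [ZMod.intCast_eq_intCast_iff_dvd_sub] at hji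
    obtain ⟨t, ht⟩ := (Int.natAbs_dvd.1 hji)
    have := hper.int_mul t j
    refine Eq.trans ?_ (this.symm.trans ?_)
    · rfl
    show f _ = f _
    congr 2
    simp only [Int.cast_id]
    linarith

theorem aux_card_inj {p : ℕ} (hp : p.Prime) (a b : ℕ)
    (h : Nat.card (ZMod a → ZMod p) = Nat.card (ZMod b → ZMod p)) : a = b := by
  have := Fact.mk hp
  have h0 : Nat.card (ZMod 0 → ZMod p) = 0 := by
    have : Infinite (ZMod 0) := inferInstanceAs (Infinite ℤ)
    exact Nat.card_eq_zero_of_infinite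
  have h1 : ∀ a, a ≠ 0 → Nat.card (ZMod a → ZMod p) = p ^ a := by
    intro a ha
    have : NeZero a := ⟨ha⟩
    rw [Nat.card_fun, Nat.card_zmod, Nat.card_zmod]
  have hpos : ∀ a, p ^ a ≠ 0 := fun a => pow_ne_zero _ hp.ne_zero
  by_cases ha : a = 0 <;> by_cases hb : b = 0
  · omega
  · subst ha; rw [h0, h1 b hb] at h; exact absurd h.symm (hpos b)
  · subst hb; rw [h0, h1 a ha] at h; exact absurd h (hpos a)
  · rw [h1 a ha, h1 b hb] at h; exact Nat.pow_right_injective hp.two_le h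

theorem aux_unit (p k : ℕ) (hp : p.Prime) (hk : 1 ≤ k) (hd : p ∣ p ^ k) (x : ZMod (p ^ k)) :
    IsUnit x ↔ ZMod.castHom hd (ZMod p) x ≠ 0 := by
  have := Fact.mk hp
  have : NeZero (p ^ k) := ⟨pow_ne_zero _ hp.ne_zero⟩
  rw [← isUnit_iff_ne_zero]
  conv_lhs => rw [← ZMod.natCast_zmod_val x]
  conv_rhs => rw [← ZMod.natCast_zmod_val x, map_natCast]
  rw [ZMod.isUnit_iff_coprime, ZMod.isUnit_iff_coprime, Nat.coprime_pow_right_iff (by omega)]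

theorem aux_mem (p k : ℕ) (hp : p.Prime) (hk : 1 ≤ k) (hd : p ∣ p ^ k) (lam : ℤ →₀ ZMod (p ^ k))
    (i : ℤ) : i ∈ redSupp (p ^ k) lam ↔ ZMod.castHom hd (ZMod p) (lam i) ≠ 0 := by
  unfold redSupp
  classical
  rw [@Finset.mem_filter _ _ (Classical.decPred _), aux_unit p k hp hk hd, Finsupp.mem_support_iff]
  constructor
  · exact fun h => h.2
  · intro h
    refine ⟨fun h0 => h (by rw [h0, map_zero]), h⟩

/-- the reduced support is a singleton -/
theorem aux_mono (p k : ℕ) (hp : p.Prime) (hk : 1 ≤ k) (hd : p ∣ p ^ k) (lam : ℤ →₀ ZMod (p ^ k))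
    (hbij : Function.Bijective (SCA (p ^ k) lam)) : ∃ j, redSupp (p ^ k) lam = {j} := by
  have := Fact.mk hp
  obtain ⟨μ, hμ⟩ := hbij.2 (Finsupp.single 0 1)
  set π := ZMod.castHom hd (ZMod p) with hπ
  have key : ∀ n : ℤ, ∑ i ∈ lam.support, π (lam i) * π (μ (n + i)) = if n = 0 then 1 else 0 := by
    intro n
    have := congrArg (fun a => π (a n)) hμ
    simp only [aux_sca_apply, map_sum, map_mul] at this
    rw [this, Finsupp.single_apply]
    by_cases h : n = 0
    · simp [h]
    · rw [if_neg (fun h' => h h'.symm), if_neg h, map_zero]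
  have hm : ∀ (l : ℤ →₀ ZMod (p ^ k)) i, i ∈ redSupp (p ^ k) l ↔ π (l i) ≠ 0 :=
    fun l i => aux_mem p k hp hk hd l i
  have h0 := key 0
  rw [if_pos rfl] at h0
  obtain ⟨i, _, hi⟩ := Finset.exists_ne_zero_of_sum_ne_zero (h0 ▸ one_ne_zero)
  have hl : (redSupp (p ^ k) lam).Nonempty := ⟨i, (hm _ _).2 (left_ne_zero_of_mul hi)⟩
  have hu : (redSupp (p ^ k) μ).Nonempty := ⟨0 + i, (hm _ _).2 (right_ne_zero_of_mul hi)⟩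
  have gen : ∀ r s, r ∈ redSupp (p ^ k) lam → s ∈ redSupp (p ^ k) μ →
      (∀ i, i ≠ r → i ∈ redSupp (p ^ k) lam → s - r + i ∈ redSupp (p ^ k) μ → False) → s = r := by
    intro r s hr hs hall
    have hk := key (s - r)
    rw [Finset.sum_eq_single r] at hk
    · by_contra hne
      rw [if_neg (by omega), sub_add_cancel] at hk
      exact mul_ne_zero ((hm _ _).1 hr) ((hm _ _).1 hs) hk
    · intro i _ hir
      by_contra hne
      exact hall i hir ((hm _ _).2 (left_ne_zero_of_mul hne)) ((hm _ _).2 (right_ne_zero_of_mul hne))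
    · intro h
      rw [Finsupp.notMem_support_iff.1 h, map_zero, zero_mul]
  have e1 := gen _ _ (Finset.max'_mem _ hl) (Finset.min'_mem _ hu) (by
    intro i h1 h2 h3
    have := Finset.le_max' _ _ h2
    have := Finset.min'_le _ _ h3
    omega)
  have e2 := gen _ _ (Finset.min'_mem _ hl) (Finset.max'_mem _ hu) (by
    intro i h1 h2 h3
    have := Finset.min'_le _ _ h2
    have := Finset.le_max' _ _ h3
    omega)
  have e3 := Finset.min'_le _ _ (Finset.max'_mem _ hu)
  refine ⟨(redSupp (p ^ k) lam).max' hl, ?_⟩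
  ext i
  rw [Finset.mem_singleton]
  constructor
  · intro h
    have := Finset.min'_le _ _ h
    have := Finset.le_max' _ _ h
    omega
  · rintro rfl
    exact Finset.max'_mem _ hl

theorem aux_T_pow (m : ℕ) (n : ℤ) (r : ℕ) (i : ℤ) :
    (auxT m n ^ r) (Finsupp.single i 1) = Finsupp.single (i + r * n) 1 := by
  induction r generalizing i with
  | zero => simp
  | succ r ih =>
    rw [pow_succ, aux_mul_apply]
    have : auxT m n (Finsupp.single i 1) = Finsupp.single (i + n) 1 := by
      show shiftT m n _ = _
      simp [shiftT, Finsupp.equivMapDomain_single]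
    rw [this, ih]
    congr 1
    push_cast
    ring

theorem aux_S_pow (p k : ℕ) (hp : p.Prime) (hk : 1 ≤ k) (hd : p ∣ p ^ k) (lam : ℤ →₀ ZMod (p ^ k))
    (j : ℤ) (hj : redSupp (p ^ k) lam = {j}) (r : ℕ) (f : (ℤ →₀ ZMod (p ^ k)) →+ ZMod p) (i : ℤ) :
    f ((auxS (p ^ k) lam ^ r) (Finsupp.single i 1)) =
      ZMod.castHom hd (ZMod p) (lam j) ^ r * f (Finsupp.single (i + r * (-j)) 1) := by
  have : NeZero (p ^ k) := ⟨pow_ne_zero _ hp.ne_zero⟩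
  induction r generalizing f i with
  | zero => simp
  | succ r ih =>
    rw [pow_succ', aux_mul_apply]
    have h1 := ih (f.comp (auxS (p ^ k) lam)) i
    refine h1.trans ?_
    have h2 : ∀ i, f (SCA (p ^ k) lam (Finsupp.single i 1)) =
        ZMod.castHom hd (ZMod p) (lam j) * f (Finsupp.single (i - j) 1) := by
      intro i
      rw [aux_sca_single, Finsupp.sum, map_sum, Finset.sum_eq_single j]
      · rw [aux_hom_single hd]
      · intro b _ hb
        rw [aux_hom_single hd]
        have : b ∉ redSupp (p ^ k) lam := by rw [hj]; simpa using hb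
        rw [aux_mem p k hp hk hd, not_not] at this
        rw [this, zero_mul]
      · intro h
        rw [Finsupp.notMem_support_iff.1 h, Finsupp.single_zero, map_zero]
    have h3 := h2 (i + r * (-j))
    have h4 : i + (r : ℤ) * (-j) - j = i + ((r + 1 : ℕ) : ℤ) * (-j) := by push_cast; ring
    rw [h4] at h3
    rw [pow_succ, mul_assoc, ← h3]
    rfl

end aux

theorem stmt19 (p k : ℕ) (hp : p.Prime) (hk : 1 ≤ k) (lam : ℤ →₀ ZMod (p ^ k))
    (hbij : Function.Bijective (SCA (p ^ k) lam)) (n : ℤ)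
    (ξ : (ℤ →₀ ZMod (p ^ k)) ≃+ (ℤ →₀ ZMod (p ^ k)))
    (hconj : ∀ a, SCA (p ^ k) lam a = ξ.symm (shiftT (p ^ k) n (ξ a))) :
    |n| = degS (p ^ k) lam := by
  have hd : p ∣ p ^ k := dvd_pow_self p (by omega)
  have := Fact.mk hp
  have : NeZero (p ^ k) := ⟨pow_ne_zero _ hp.ne_zero⟩
  obtain ⟨j, hj⟩ := aux_mono p k hp hk hd lam hbij
  have hdeg : degS (p ^ k) lam = |j| := by
    unfold degS
    rw [dif_pos (by rw [hj]; exact Finset.singleton_nonempty j)]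
    simp only [hj, Finset.max'_singleton, Finset.min'_singleton]
    rcases le_total j 0 with h | h
    · rw [abs_of_nonpos h, max_eq_right h, min_eq_left h]; ring
    · rw [abs_of_nonneg h, max_eq_left h, min_eq_right h]; ring
  rw [hdeg]
  have hunit : ZMod.castHom hd (ZMod p) (lam j) ≠ 0 :=
    (aux_mem p k hp hk hd lam j).1 (by rw [hj]; simp)
  have c1 := aux_card hd (auxS (p ^ k) lam ^ (p - 1)) (((p - 1 : ℕ) : ℤ) * (-j)) (by
    intro f i
    rw [aux_S_pow p k hp hk hd lam j hj, ZMod.pow_card_sub_one_eq_one hunit, one_mul])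
  have c2 := aux_card (p := p) hd (auxT (p ^ k) n ^ (p - 1)) (((p - 1 : ℕ) : ℤ) * n) (by
    intro f i
    rw [aux_T_pow])
  have hc : ∀ (r : ℕ) a, ξ ((auxS (p ^ k) lam ^ r) a) = (auxT (p ^ k) n ^ r) (ξ a) := by
    intro r
    induction r with
    | zero => intro a; simp
    | succ r ih =>
      intro a
      rw [pow_succ, pow_succ, aux_mul_apply, aux_mul_apply, ih]
      congr 1
      show ξ (SCA (p ^ k) lam a) = shiftT (p ^ k) n (ξ a)
      rw [hconj, AddEquiv.apply_symm_apply]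
  have c3 : Nat.card {f : (ℤ →₀ ZMod (p ^ k)) →+ ZMod p //
        ∀ a, f ((auxT (p ^ k) n ^ (p - 1)) a) = f a}
      = Nat.card {f : (ℤ →₀ ZMod (p ^ k)) →+ ZMod p //
        ∀ a, f ((auxS (p ^ k) lam ^ (p - 1)) a) = f a} := by
    refine Nat.card_congr
      { toFun := fun f => ⟨f.1.comp ξ.toAddMonoidHom, fun a => ?_⟩
        invFun := fun f => ⟨f.1.comp ξ.symm.toAddMonoidHom, fun a => ?_⟩
        left_inv := fun f => ?_
        right_inv := fun f => ?_ }
    · show f.1 (ξ _) = f.1 (ξ a)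
      rw [hc, f.2]
    · show f.1 (ξ.symm _) = f.1 (ξ.symm a)
      have := hc (p - 1) (ξ.symm a)
      rw [AddEquiv.apply_symm_apply] at this
      rw [← this, AddEquiv.symm_apply_apply, f.2]
    · apply Subtype.ext
      apply AddMonoidHom.ext
      intro a
      show f.1 (ξ (ξ.symm a)) = f.1 a
      rw [AddEquiv.apply_symm_apply]
    · apply Subtype.ext
      apply AddMonoidHom.ext
      intro a
      show f.1 (ξ.symm (ξ a)) = f.1 a
      rw [AddEquiv.symm_apply_apply]
  have := aux_card_inj hp _ _ (c2.symm.trans (c3.trans c1))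
  rw [Int.natAbs_mul, Int.natAbs_mul, Int.natAbs_neg] at this
  have hp1 : 0 < ((p - 1 : ℕ) : ℤ).natAbs := by
    have := hp.two_le
    omega
  have := Nat.eq_of_mul_eq_mul_left hp1 this
  rw [Int.abs_eq_natAbs, Int.abs_eq_natAbs, this]
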